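/- arXiv:1209.2620 — 3 statements merged into one kernel-verified Lean document; each statement's English description precedes it below -/
import Mathlib

section
/- Let L be a countable language possessing at least one closed term, t_1, t_2, … an enumeration of all closed L-terms, μ a probability on sentences, and φ an L-formula with exactly one free variable x. Assume μ(⋀_{i=1}^n φ[x := t_i]) > 0 for every n. Then lim_{n→∞} μ(∀x. φ | ⋀_{i=1}^n φ[x := t_i]) = 1 if and only if both lim_{n→∞} μ(⋀_{i=1}^n φ[x := t_i]) = μ(∀x. φ) and μ(∀x. φ) > 0. -/
open FirstOrder Language Filter

/-- A sentence is valid if it is satisfied by every nonempty structure. -/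
def IsValidSentence (L : FirstOrder.Language) (φ : L.Sentence) : Prop :=
  ∀ (M : Type) [Nonempty M] [L.Structure M], M ⊨ φ

/-- A probability on sentences. -/
structure SentenceProb (L : FirstOrder.Language) where
  toFun : L.Sentence → ℝ
  nonneg : ∀ φ, 0 ≤ toFun φ
  valid_one : ∀ φ, IsValidSentence L φ → toFun φ = 1
  add : ∀ φ ψ, IsValidSentence L (∼(φ ⊓ ψ)) → toFun (φ ⊔ ψ) = toFun φ + toFun ψ

/-- Substitute the closed term `t` for the unique (bound) variable of `φ`,
yielding the sentence `φ[x := t]`. -/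
def instantiate {L : FirstOrder.Language} (φ : L.BoundedFormula Empty 1)
    (t : L.Term Empty) : L.Sentence :=
  φ.toFormula.subst (fun _ => t)

/-- The disjunction `φ[x := t] ∨ φ[x := s₁] ∨ ⋯ ∨ φ[x := s_m]` over the
nonempty finite collection of closed terms `t :: l`. -/
def disjOf {L : FirstOrder.Language} (φ : L.BoundedFormula Empty 1)
    (t : L.Term Empty) (l : List (L.Term Empty)) : L.Sentence :=
  l.foldl (fun χ s => χ ⊔ instantiate φ s) (instantiate φ t)

/-- The conjunction `φ[x := t] ∧ φ[x := s₁] ∧ ⋯ ∧ φ[x := s_m]` over the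
nonempty finite collection of closed terms `t :: l`. -/
def conjOf {L : FirstOrder.Language} (φ : L.BoundedFormula Empty 1)
    (t : L.Term Empty) (l : List (L.Term Empty)) : L.Sentence :=
  l.foldl (fun χ s => χ ⊓ instantiate φ s) (instantiate φ t)

/-- `⋁_{i=0}^n φ[x := t_i]`. -/
def disjUpTo {L : FirstOrder.Language} (φ : L.BoundedFormula Empty 1)
    (t : ℕ → L.Term Empty) : ℕ → L.Sentence
  | 0 => instantiate φ (t 0)
  | n + 1 => disjUpTo φ t n ⊔ instantiate φ (t (n + 1))

/-- `⋀_{i=0}^n φ[x := t_i]`. -/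
def conjUpTo {L : FirstOrder.Language} (φ : L.BoundedFormula Empty 1)
    (t : ℕ → L.Term Empty) : ℕ → L.Sentence
  | 0 => instantiate φ (t 0)
  | n + 1 => conjUpTo φ t n ⊓ instantiate φ (t (n + 1))

section

variable {L : FirstOrder.Language}

lemma SentenceProb.congr (μ : SentenceProb L) {φ ψ : L.Sentence}
    (h : ∀ (M : Type) [Nonempty M] [L.Structure M], M ⊨ φ ↔ M ⊨ ψ) :
    μ.toFun φ = μ.toFun ψ := by
  have key : ∀ χ : L.Sentence,
      (∀ (M : Type) [Nonempty M] [L.Structure M], M ⊨ χ ↔ M ⊨ ψ) →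
      μ.toFun χ + μ.toFun (∼ψ) = 1 := by
    intro χ hχ
    rw [← μ.add, μ.valid_one]
    · intro M _ _
      have := hχ M
      simp only [Sentence.Realize, Formula.Realize, BoundedFormula.realize_sup,
        BoundedFormula.realize_not] at this ⊢
      tauto
    · intro M _ _
      have := hχ M
      simp only [Sentence.Realize, Formula.Realize, BoundedFormula.realize_inf,
        BoundedFormula.realize_not] at this ⊢
      tauto
  linarith [key φ h, key ψ fun _ _ _ => Iff.rfl]

lemma realize_instantiate_of_realize_all {M : Type*} [L.Structure M]
    {φ : L.BoundedFormula Empty 1} (h : M ⊨ (∀'φ)) (s : L.Term Empty) :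
    M ⊨ instantiate φ s := by
  simp only [Sentence.Realize, Formula.Realize, BoundedFormula.realize_all] at h
  simp only [instantiate, Sentence.Realize, Formula.Realize, BoundedFormula.realize_subst]
  refine (BoundedFormula.realize_toFormula φ _).2 ?_
  convert h (s.realize default) using 1
  ext i
  rw [Subsingleton.elim i (Fin.last 0), Fin.snoc_last]
  rfl

lemma realize_conjUpTo_of_realize_all {M : Type*} [L.Structure M]
    {φ : L.BoundedFormula Empty 1} (h : M ⊨ (∀'φ)) (t : ℕ → L.Term Empty) (n : ℕ) :
    M ⊨ conjUpTo φ t n := by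
  induction n with
  | zero => exact realize_instantiate_of_realize_all h _
  | succ n ih =>
    exact BoundedFormula.realize_inf.2 ⟨ih, realize_instantiate_of_realize_all h _⟩

lemma SentenceProb.all_inf_conjUpTo (μ : SentenceProb L) (φ : L.BoundedFormula Empty 1)
    (t : ℕ → L.Term Empty) (n : ℕ) :
    μ.toFun ((∀'φ) ⊓ conjUpTo φ t n) = μ.toFun (∀'φ) :=
  μ.congr fun _ _ _ =>
    ⟨fun h => (BoundedFormula.realize_inf.1 h).1,
      fun h => BoundedFormula.realize_inf.2 ⟨h, realize_conjUpTo_of_realize_all h t n⟩⟩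

end


theorem confirming_universal_hypotheses {L : FirstOrder.Language}
    [Countable L.Symbols] (μ : SentenceProb L)
    (t : ℕ → L.Term Empty) (ht : Function.Surjective t)
    (φ : L.BoundedFormula Empty 1)
    (hpos : ∀ n, 0 < μ.toFun (conjUpTo φ t n)) :
    Tendsto (fun n => μ.toFun ((∀'φ) ⊓ conjUpTo φ t n) / μ.toFun (conjUpTo φ t n))
        atTop (nhds 1) ↔
      (Tendsto (fun n => μ.toFun (conjUpTo φ t n)) atTop (nhds (μ.toFun (∀'φ))) ∧
        0 < μ.toFun (∀'φ)) := by
  simp only [μ.all_inf_conjUpTo]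
  constructor
  · intro h
    have hp : 0 < μ.toFun (∀'φ) := by
      refine (μ.nonneg _).lt_of_ne fun h0 => ?_
      simp [← h0, tendsto_const_nhds_iff] at h
    refine ⟨?_, hp⟩
    have := (tendsto_const_nhds (x := μ.toFun (∀'φ))).div h one_ne_zero
    simpa [Pi.div_def, div_div_cancel₀ hp.ne'] using this
  · rintro ⟨h, hp⟩
    have := (tendsto_const_nhds (x := μ.toFun (∀'φ))).div h hp.ne'
    rwa [div_self hp.ne'] at this
end

section
/- If the language L is countable, then there exists a probability on L-sentences that is strongly Cournot, i.e., a probability μ such that μ(φ) > 0 for every satisfiable sentence φ. -/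
open FirstOrder Language Filter

/-- A sentence is satisfiable if it is satisfied by some nonempty structure. -/
def IsSatisfiableSentence (L : FirstOrder.Language) (φ : L.Sentence) : Prop :=
  ∃ (M : Type) (_ : L.Structure M), Nonempty M ∧ M ⊨ φ

/-- The mixture of the truth values of a sequence of nonempty structures, where the `n`-th
structure has weight `1 / 2 ^ (n + 1)`. -/
noncomputable def mixtureProb (L : FirstOrder.Language) (M : ℕ → Type)
    [∀ n, L.Structure (M n)] [∀ n, Nonempty (M n)] : SentenceProb L where
  toFun φ := ∑' n, {n | M n ⊨ φ}.indicator (fun n => (1 : ℝ) / 2 / 2 ^ n) n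
  nonneg φ := tsum_nonneg fun n => Set.indicator_nonneg (fun _ _ => by positivity) n
  valid_one φ h := by
    have huniv : {n | M n ⊨ φ} = Set.univ := Set.eq_univ_of_forall fun n => h (M n)
    simpa only [huniv, Set.indicator_univ] using tsum_geometric_two' 1
  add φ ψ h := by
    have hdisj : Disjoint {n | M n ⊨ φ} {n | M n ⊨ ψ} :=
      Set.disjoint_left.2 fun n h₁ h₂ => by
        have := h (M n)
        rw [Sentence.realize_not] at this
        exact this (BoundedFormula.realize_inf.2 ⟨h₁, h₂⟩)
    have hunion : {n | M n ⊨ φ ⊔ ψ} = {n | M n ⊨ φ} ∪ {n | M n ⊨ ψ} :=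
      Set.ext fun n => BoundedFormula.realize_sup
    have hsum : Summable fun n : ℕ => (1 : ℝ) / 2 / 2 ^ n := summable_geometric_two' 1
    rw [hunion, Set.indicator_union_of_disjoint hdisj]
    exact (hsum.indicator _).tsum_add (hsum.indicator _)

theorem mixtureProb_pos (L : FirstOrder.Language) (M : ℕ → Type)
    [∀ n, L.Structure (M n)] [∀ n, Nonempty (M n)] {φ : L.Sentence} {n : ℕ} (h : M n ⊨ φ) :
    0 < (mixtureProb L M).toFun φ := by
  refine ((summable_geometric_two' 1).indicator _).tsum_pos
    (fun k => Set.indicator_nonneg (fun _ _ => by positivity) k) n ?_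
  rw [Set.indicator_of_mem (show n ∈ {n | M n ⊨ φ} from h)]
  positivity

theorem exists_strongly_cournot_probability
    (L : FirstOrder.Language) [Countable L.Symbols] :
    ∃ μ : SentenceProb L,
      ∀ φ : L.Sentence, IsSatisfiableSentence L φ → 0 < μ.toFun φ := by
  have hcount : Countable L.Sentence := inferInstanceAs (Countable (L.Formula Empty))
  have hne : Nonempty {φ : L.Sentence // IsSatisfiableSentence L φ} := by
    let _ : L.Structure Unit := ⟨fun _ _ => (), fun _ _ => True⟩
    exact ⟨⊤, Unit, inferInstance, inferInstance, BoundedFormula.realize_top.2 trivial⟩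
  obtain ⟨e, he⟩ := exists_surjective_nat {φ : L.Sentence // IsSatisfiableSentence L φ}
  choose M inst hM hreal using fun n => (e n).2
  refine ⟨mixtureProb L M, fun φ hφ => ?_⟩
  obtain ⟨n, hn⟩ := he ⟨φ, hφ⟩
  have := hreal n
  rw [hn] at this
  exact mixtureProb_pos L M this
end

section
/- Let L be a countable language and χ_1, χ_2, … an enumeration of all satisfiable L-sentences. A probability on sentences μ is strongly Cournot if and only if it admits a rigid mixture representation: there exist reals m_i > 0 with Σ_{i=1}^∞ m_i = 1 and probabilities on sentences μ_i with μ_i(χ_i) = 1 for each i, such that μ(φ) = Σ_{i=1}^∞ m_i μ_i(φ) for every sentence φ. -/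
open FirstOrder Language Filter

namespace SentenceProb

variable {L : FirstOrder.Language}

/-- Semantically equivalent sentences have the same probability. -/
theorem congr_of_equiv (μ : SentenceProb L) {φ ψ : L.Sentence}
    (h : ∀ (M : Type) [Nonempty M] [L.Structure M], M ⊨ φ ↔ M ⊨ ψ) :
    μ.toFun φ = μ.toFun ψ := by
  have hφ : μ.toFun (φ ⊔ ∼φ) = μ.toFun φ + μ.toFun (∼φ) := μ.add _ _ fun M _ _ => by
    simp [Sentence.Realize]
  have hψ : μ.toFun (ψ ⊔ ∼φ) = μ.toFun ψ + μ.toFun (∼φ) := μ.add _ _ fun M _ _ => by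
    have := h M
    simp_all [Sentence.Realize]
  have hφ' : μ.toFun (φ ⊔ ∼φ) = 1 := μ.valid_one _ fun M _ _ => by
    simp [Sentence.Realize, em]
  have hψ' : μ.toFun (ψ ⊔ ∼φ) = 1 := μ.valid_one _ fun M _ _ => by
    have := h M
    simp_all [Sentence.Realize, em]
  linarith

/-- Probability is monotone under semantic entailment. -/
theorem mono_of_entails (μ : SentenceProb L) {φ ψ : L.Sentence}
    (h : ∀ (M : Type) [Nonempty M] [L.Structure M], M ⊨ φ → M ⊨ ψ) :
    μ.toFun φ ≤ μ.toFun ψ := by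
  have hadd : μ.toFun (φ ⊔ (ψ ⊓ ∼φ)) = μ.toFun φ + μ.toFun (ψ ⊓ ∼φ) :=
    μ.add _ _ fun M _ _ => by
      simp only [Sentence.Realize, Formula.realize_not, Formula.realize_inf]
      tauto
  have heq : μ.toFun (φ ⊔ (ψ ⊓ ∼φ)) = μ.toFun ψ := μ.congr_of_equiv fun M _ _ => by
    have := h M
    simp only [Sentence.Realize, Formula.realize_not, Formula.realize_inf,
      Formula.realize_sup] at this ⊢
    tauto
  linarith [μ.nonneg (ψ ⊓ ∼φ)]

theorem inf_le_left (μ : SentenceProb L) (φ χ : L.Sentence) :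
    μ.toFun (φ ⊓ χ) ≤ μ.toFun φ :=
  μ.mono_of_entails fun M _ _ => by
    simp only [Sentence.Realize, Formula.realize_inf]
    exact And.left

theorem le_one (μ : SentenceProb L) (φ : L.Sentence) : μ.toFun φ ≤ 1 := by
  have htop : IsValidSentence L ⊤ := fun M _ _ => by simp [Sentence.Realize]
  rw [← μ.valid_one ⊤ htop]
  exact μ.mono_of_entails fun M _ _ _ => by simp [Sentence.Realize]

theorem inf_eq_of_valid (μ : SentenceProb L) {φ : L.Sentence} (χ : L.Sentence)
    (h : IsValidSentence L φ) : μ.toFun (φ ⊓ χ) = μ.toFun χ :=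
  μ.congr_of_equiv fun M _ _ => by
    have := h M
    simp_all [Sentence.Realize]

theorem sup_inf_add (μ : SentenceProb L) {φ ψ : L.Sentence} (χ : L.Sentence)
    (h : IsValidSentence L (∼(φ ⊓ ψ))) :
    μ.toFun ((φ ⊔ ψ) ⊓ χ) = μ.toFun (φ ⊓ χ) + μ.toFun (ψ ⊓ χ) := by
  rw [← μ.add]
  · exact μ.congr_of_equiv fun M _ _ => by
      simp only [Sentence.Realize, Formula.realize_inf, Formula.realize_sup]
      tauto
  · intro M _ _
    have := h M
    simp only [Sentence.Realize, Formula.realize_inf, Formula.realize_not] at this ⊢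
    tauto

/-- The conditional probability given a sentence of positive probability. -/
noncomputable def cond (μ : SentenceProb L) (χ : L.Sentence) (h : 0 < μ.toFun χ) :
    SentenceProb L where
  toFun φ := μ.toFun (φ ⊓ χ) / μ.toFun χ
  nonneg φ := div_nonneg (μ.nonneg _) h.le
  valid_one φ hφ := by rw [μ.inf_eq_of_valid χ hφ, div_self h.ne']
  add φ ψ hφψ := by rw [μ.sup_inf_add χ hφψ, add_div]

theorem cond_self (μ : SentenceProb L) (χ : L.Sentence) (h : 0 < μ.toFun χ) :
    (μ.cond χ h).toFun χ = 1 := by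
  have : μ.toFun (χ ⊓ χ) = μ.toFun χ := μ.congr_of_equiv fun M _ _ => by
    simp [Sentence.Realize]
  simp only [cond, this, div_self h.ne']

theorem summable_mul {a : ℕ → ℝ} (ha : ∀ i, 0 ≤ a i) (hs : Summable a)
    (ν : ℕ → SentenceProb L) (φ : L.Sentence) : Summable fun i => a i * (ν i).toFun φ :=
  hs.of_nonneg_of_le (fun i => mul_nonneg (ha i) ((ν i).nonneg φ))
    fun i => mul_le_of_le_one_right (ha i) ((ν i).le_one φ)

/-- The normalized remainder of `μ` after removing a submixture of total mass less than one. -/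
noncomputable def remainder (μ : SentenceProb L) (a : ℕ → ℝ) (ν : ℕ → SentenceProb L)
    (ha : ∀ i, 0 ≤ a i) (hs : Summable a) (hlt : ∑' i, a i < 1)
    (hle : ∀ φ, ∑' i, a i * (ν i).toFun φ ≤ μ.toFun φ) : SentenceProb L where
  toFun φ := (μ.toFun φ - ∑' i, a i * (ν i).toFun φ) / (1 - ∑' i, a i)
  nonneg φ := div_nonneg (sub_nonneg.2 (hle φ)) (sub_nonneg.2 hlt.le)
  valid_one φ hφ := by
    have hν i : (ν i).toFun φ = 1 := (ν i).valid_one φ hφ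
    simp only [hν, mul_one]
    rw [μ.valid_one φ hφ]
    exact div_self (sub_pos.2 hlt).ne'
  add φ ψ h := by
    simp only [μ.add φ ψ h, (ν _).add φ ψ h, mul_add]
    rw [(summable_mul ha hs ν φ).tsum_add (summable_mul ha hs ν ψ), ← add_div]
    ring

end SentenceProb

/-- The geometric weights with the weight at `k` removed still sum to less than one. -/
theorem summable_update_geometric_and_tsum_lt_one (k : ℕ) :
    Summable (Function.update (fun i : ℕ => (1 / 2 : ℝ) / 2 ^ i) k 0) ∧
      ∑' i, Function.update (fun i : ℕ => (1 / 2 : ℝ) / 2 ^ i) k 0 i < 1 := by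
  have h := (hasSum_geometric_two' (1 : ℝ)).update k 0
  refine ⟨h.summable, ?_⟩
  rw [h.tsum_eq]
  have : (0 : ℝ) < 1 / 2 / 2 ^ k := by positivity
  linarith

theorem strongly_cournot_iff_rigid_mixture_representation
    {L : FirstOrder.Language} [Countable L.Symbols]
    (χ : ℕ → L.Sentence)
    (hχsat : ∀ i, IsSatisfiableSentence L (χ i))
    (hχsurj : ∀ φ : L.Sentence, IsSatisfiableSentence L φ → ∃ i, χ i = φ)
    (μ : SentenceProb L) :
    (∀ φ : L.Sentence, IsSatisfiableSentence L φ → 0 < μ.toFun φ) ↔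
    (∃ (m : ℕ → ℝ) (ν : ℕ → SentenceProb L),
      (∀ i, 0 < m i) ∧ HasSum m 1 ∧ (∀ i, (ν i).toFun (χ i) = 1) ∧
      (∀ φ : L.Sentence, HasSum (fun i => m i * (ν i).toFun φ) (μ.toFun φ))) := by
  constructor
  · intro hμ
    have hpos i : 0 < μ.toFun (χ i) := hμ _ (hχsat i)
    obtain ⟨k, hk⟩ : ∃ k, χ k = ⊤ := by
      obtain ⟨M, inst, hM, -⟩ := hχsat 0
      exact hχsurj ⊤ ⟨M, inst, hM, by simp [Sentence.Realize]⟩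
    obtain ⟨hws, hwlt⟩ := summable_update_geometric_and_tsum_lt_one k
    set w := Function.update (fun i : ℕ => (1 / 2 : ℝ) / 2 ^ i) k 0 with hw
    have hwk : w k = 0 := by simp [hw]
    have hwpos i (hi : i ≠ k) : 0 < w i := by
      rw [hw, Function.update_of_ne hi]
      positivity
    have hw0 i : 0 ≤ w i := by
      rcases eq_or_ne i k with rfl | hi
      · exact hwk.ge
      · exact (hwpos i hi).le
    let a i := w i * μ.toFun (χ i)
    let κ i := μ.cond (χ i) (hpos i)
    have ha i : 0 ≤ a i := mul_nonneg (hw0 i) (hpos i).le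
    have haw i : a i ≤ w i := mul_le_of_le_one_right (hw0 i) (μ.le_one _)
    have has : Summable a := hws.of_nonneg_of_le ha haw
    have halt : ∑' i, a i < 1 := (has.tsum_le_tsum haw hws).trans_lt hwlt
    have hle φ : ∑' i, a i * (κ i).toFun φ ≤ μ.toFun φ := by
      calc ∑' i, a i * (κ i).toFun φ ≤ ∑' i, w i * μ.toFun φ := by
            refine (SentenceProb.summable_mul ha has κ φ).tsum_le_tsum (fun i => ?_)
              (hws.mul_right _)
            have : a i * (κ i).toFun φ = w i * μ.toFun (φ ⊓ χ i) := by
              simp only [a, κ, SentenceProb.cond]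
              field_simp [(hpos i).ne']
            rw [this]
            exact mul_le_mul_of_nonneg_left (μ.inf_le_left _ _) (hw0 i)
        _ = (∑' i, w i) * μ.toFun φ := tsum_mul_right
        _ ≤ μ.toFun φ := mul_le_of_le_one_left (μ.nonneg φ) hwlt.le
    let ρ := μ.remainder a κ ha has halt hle
    have hr : 0 < 1 - ∑' i, a i := sub_pos.2 halt
    let m := Function.update a k (1 - ∑' i, a i)
    let ν := Function.update κ k ρ
    have hmix φ : HasSum (fun i => m i * (ν i).toFun φ) (μ.toFun φ) := by
      have hmain := (SentenceProb.summable_mul ha has κ φ).hasSum.update k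
        ((1 - ∑' i, a i) * ρ.toFun φ)
      have hρ : (1 - ∑' i, a i) * ρ.toFun φ = μ.toFun φ - ∑' i, a i * (κ i).toFun φ :=
        mul_div_cancel₀ _ hr.ne'
      have hak : a k = 0 := by simp [a, hwk]
      have hfun : (fun i => m i * (ν i).toFun φ) = Function.update
          (fun i => a i * (κ i).toFun φ) k ((1 - ∑' i, a i) * ρ.toFun φ) := by
        ext i
        rcases eq_or_ne i k with rfl | hi
        · simp [m, ν]
        · simp [m, ν, hi]
      rw [hfun]
      rwa [hak, zero_mul, sub_zero, hρ, sub_add_cancel, ← hρ] at hmain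
    have htop : IsValidSentence L ⊤ := fun M _ _ => by simp [Sentence.Realize]
    refine ⟨m, ν, fun i => ?_, ?_, fun i => ?_, hmix⟩
    · rcases eq_or_ne i k with rfl | hi
      · simpa [m] using hr
      · simpa [m, hi] using mul_pos (hwpos i hi) (hpos i)
    · simpa only [(ν _).valid_one ⊤ htop, μ.valid_one ⊤ htop, mul_one] using hmix ⊤
    · rcases eq_or_ne i k with rfl | hi
      · rw [hk]
        exact (ν i).valid_one ⊤ htop
      · simpa only [ν, Function.update_of_ne hi] using μ.cond_self (χ i) (hpos i)
  · rintro ⟨m, ν, hm, -, hν, hsum⟩ φ hφ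
    obtain ⟨i, rfl⟩ := hχsurj φ hφ
    refine (hm i).trans_le ?_
    have := le_hasSum (hsum (χ i)) i fun j _ => mul_nonneg (hm j).le ((ν j).nonneg _)
    simpa [hν i] using this
end
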